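/- Let n ≥ 2, λ > 0, and let V, D : ℝⁿ → ℝ be continuous radial functions that are Hölder continuous of some exponent δ > 0 on the ball B_δ, with V ≥ 0 and D ≥ −λ − V/λ. Suppose there exist d_∞ ∈ ℝ and R > 1 such that, as functions of r = |x| on [R, ∞), V(r) ∈ L¹([R,∞)) and D(r) = d_∞/r + D_∞(r) with D_∞ ∈ L¹([R,∞)). Then there exists a C² function φ_λ : ℝⁿ → ℝ solving Δφ_λ = (λ² + λD + V)φ_λ on ℝⁿ, together with positive constants c₁, c₂ such that c₁⟨|x|⟩^{−(n−1−d_∞)/2} e^{λ|x|} ≤ φ_λ(x) ≤ c₂⟨|x|⟩^{−(n−1−d_∞)/2} e^{λ|x|} for all x ∈ ℝⁿ. -/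

import Mathlib

open MeasureTheory Real Set Metric NNReal

noncomputable section

/-- The Laplacian of `f : ℝⁿ → ℝ`. -/
def lap {n : ℕ} (f : EuclideanSpace ℝ (Fin n) → ℝ) (x : EuclideanSpace ℝ (Fin n)) : ℝ :=
  ∑ i : Fin n, fderiv ℝ (fun y => fderiv ℝ f y (EuclideanSpace.single i 1)) x
    (EuclideanSpace.single i 1)

lemma cont_I (m : ℕ) (f : ℝ → ℝ) (hf : Continuous f) :
    Continuous (fun s : ℝ => ∫ τ in (0:ℝ)..1, τ^m * f (s*τ)) := by
  apply intervalIntegral.continuous_parametric_intervalIntegral_of_continuous'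
  simp only [Function.uncurry_def]; fun_prop

lemma exists_radial (m : ℕ) (q : ℝ → ℝ) (hq : Continuous q) (hq0 : ∀ r, 0 ≤ q r) :
    ∃ φ : ℝ → ℝ, Continuous φ ∧ (∀ r, 0 ≤ φ r) ∧ ∀ r, 0 ≤ r →
      φ r = 1 + ∫ s in (0:ℝ)..r, s * ∫ τ in (0:ℝ)..1, τ^m * (q (s*τ) * φ (s*τ)) := by
  obtain ⟨P, hP⟩ : ∃ P : ℝ → ℝ, P = fun s : ℝ => ∫ τ in (0:ℝ)..1, q (s*τ) := ⟨_, rfl⟩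
  have hPc : Continuous P := by
    have := cont_I 0 q hq
    simpa [hP] using this
  have hP0 : ∀ s, 0 ≤ P s := fun s => by
    rw [hP]; exact intervalIntegral.integral_nonneg zero_le_one (fun _ _ => hq0 _)
  obtain ⟨κ, hκ⟩ : ∃ κ : ℝ → ℝ, κ = fun r : ℝ => ∫ s in (0:ℝ)..r, 2 * s * P s := ⟨_, rfl⟩
  have hκd : ∀ r, HasDerivAt κ (2 * r * P r) r := fun r => by
    rw [hκ]
    have hc : Continuous (fun s => 2 * s * P s) := by fun_prop
    exact intervalIntegral.integral_hasDerivAt_right (hc.intervalIntegrable _ _)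
      (hc.stronglyMeasurableAtFilter _ _) hc.continuousAt
  have hκc : Continuous κ := continuous_iff_continuousAt.2 fun r => (hκd r).continuousAt
  have hκm : MonotoneOn κ (Ici 0) := by
    apply monotoneOn_of_deriv_nonneg (convex_Ici 0) hκc.continuousOn
    · intro x _; exact (hκd x).differentiableAt.differentiableWithinAt
    · intro x hx
      rw [interior_Ici] at hx
      rw [(hκd x).deriv]
      have := hP0 x
      have : 0 < x := hx
      positivity
  have hκz : κ 0 = 0 := by simp [hκ]
  obtain ⟨I, hI⟩ : ∃ I : BoundedContinuousFunction ℝ ℝ → ℝ → ℝ, I = fun b s =>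
    ∫ τ in (0:ℝ)..1, τ^m * (q (s*τ) * (exp (κ (s*τ)) * b (s*τ))) := ⟨_, rfl⟩
  have hIc : ∀ b, Continuous (I b) := fun b => by
    rw [hI]
    exact cont_I m (fun t => q t * (exp (κ t) * b t)) (by fun_prop)
  have hIb : ∀ b : BoundedContinuousFunction ℝ ℝ, ∀ s, 0 ≤ s → |I b s| ≤ P s * exp (κ s) * ‖b‖ := by
    intro b s hs
    have h1 : P s * exp (κ s) * ‖b‖ = ∫ τ in (0:ℝ)..1, q (s*τ) * (exp (κ s) * ‖b‖) := by
      rw [intervalIntegral.integral_mul_const, hP]; ring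
    rw [h1, hI, ← Real.norm_eq_abs]
    apply intervalIntegral.norm_integral_le_of_norm_le zero_le_one
    · refine Filter.Eventually.of_forall fun τ hτ => ?_
      have h0 : 0 ≤ τ := hτ.1.le
      have hle : κ (s*τ) ≤ κ s := hκm (mul_nonneg hs h0) hs (by nlinarith [hτ.2])
      have h2 : τ^m ≤ 1 := pow_le_one₀ h0 hτ.2
      have h3 := b.norm_coe_le_norm (s*τ)
      rw [norm_mul, norm_mul, norm_mul, Real.norm_of_nonneg (hq0 _), Real.norm_of_nonneg (exp_pos _).le,
        Real.norm_of_nonneg (pow_nonneg h0 m)]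
      have h4 : exp (κ (s*τ)) * ‖b (s*τ)‖ ≤ exp (κ s) * ‖b‖ := by gcongr
      have h5 := hq0 (s*τ)
      calc τ^m * (q (s*τ) * (exp (κ (s*τ)) * ‖b (s*τ)‖)) ≤ 1 * (q (s*τ) * (exp (κ s) * ‖b‖)) := by
            gcongr
        _ = _ := one_mul _
    · apply Continuous.intervalIntegrable; fun_prop
  have hIsub : ∀ b b' s, I b s - I b' s = I (b - b') s := by
    intro b b' s
    rw [hI]
    dsimp only
    rw [← intervalIntegral.integral_sub]
    · congr 1; ext τ; simp; ring
    all_goals apply Continuous.intervalIntegrable; fun_prop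
  obtain ⟨J, hJ⟩ : ∃ J : BoundedContinuousFunction ℝ ℝ → ℝ → ℝ, J = fun b r =>
    ∫ s in (0:ℝ)..r, s * I b s := ⟨_, rfl⟩
  have hJc : ∀ b, Continuous (J b) := fun b => by
    rw [hJ]
    have := hIc b
    exact intervalIntegral.continuous_primitive
      (fun a b => Continuous.intervalIntegrable (by fun_prop) _ _) 0
  have hJsub : ∀ b b' s, J b s - J b' s = J (b - b') s := by
    intro b b' s
    have := hIc b
    have := hIc b'
    rw [hJ]
    dsimp only
    rw [← intervalIntegral.integral_sub]
    · congr 1; ext τ; rw [← hIsub]; ring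
    all_goals apply Continuous.intervalIntegrable; fun_prop
  have hint : ∀ r, ∫ s in (0:ℝ)..r, s * P s * exp (κ s) = (exp (κ r) - 1) / 2 := by
    intro r
    rw [intervalIntegral.integral_eq_sub_of_hasDerivAt (f := fun r => exp (κ r) / 2)]
    · simp only [hκz, exp_zero]; ring
    · intro x _
      exact (((hκd x).exp).div_const 2).congr_deriv (by ring)
    · apply Continuous.intervalIntegrable; fun_prop
  have hJb : ∀ b : BoundedContinuousFunction ℝ ℝ, ∀ r, 0 ≤ r → |J b r| ≤ exp (κ r) * (‖b‖ / 2) := by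
    intro b r hr
    have h1 : |J b r| ≤ ∫ s in (0:ℝ)..r, s * P s * exp (κ s) * ‖b‖ := by
      rw [hJ, ← Real.norm_eq_abs]
      apply intervalIntegral.norm_integral_le_of_norm_le hr
      · refine Filter.Eventually.of_forall fun s hs => ?_
        have := hIb b s hs.1.le
        rw [norm_mul, Real.norm_of_nonneg hs.1.le, Real.norm_eq_abs]
        have := mul_le_mul_of_nonneg_left this hs.1.le
        linarith
      · apply Continuous.intervalIntegrable; fun_prop
    rw [intervalIntegral.integral_mul_const, hint] at h1
    have := norm_nonneg b
    nlinarith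
  have hSc : ∀ b, Continuous (fun r : ℝ => exp (-κ |r|) * (1 + J b |r|)) := fun b => by
    have := hJc b
    fun_prop
  have hSb : ∀ b : BoundedContinuousFunction ℝ ℝ, ∀ r : ℝ, |exp (-κ (|r|)) * J b (|r|)| ≤ ‖b‖ / 2 := by
    intro b r
    rw [abs_mul, abs_of_pos (exp_pos _)]
    calc _ ≤ exp (-κ |r|) * (exp (κ |r|) * (‖b‖/2)) := by
            gcongr; exact hJb b _ (abs_nonneg r)
      _ = _ := by rw [← mul_assoc, ← exp_add]; simp
  let S : BoundedContinuousFunction ℝ ℝ → BoundedContinuousFunction ℝ ℝ := fun b =>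
    BoundedContinuousFunction.ofNormedAddCommGroup (fun r : ℝ => exp (-κ |r|) * (1 + J b |r|))
      (hSc b) (1 + ‖b‖ / 2) (by
        intro r
        have h1 := hSb b r
        have h2 : exp (-κ |r|) ≤ 1 := by
          rw [exp_le_one_iff]
          have := hκm (mem_Ici.2 le_rfl) (mem_Ici.2 (abs_nonneg r)) (abs_nonneg r)
          rw [hκz] at this
          linarith
        rw [mul_add, mul_one]
        refine (norm_add_le _ _).trans ?_
        rw [Real.norm_of_nonneg (exp_pos _).le, Real.norm_eq_abs]
        linarith)
  have hS : ∀ b r, S b r = exp (-κ |r|) * (1 + J b |r|) := fun b r => rfl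
  have hcon : ContractingWith (1/2 : ℝ≥0) S := by
    refine ⟨by rw [← NNReal.coe_lt_coe]; norm_num, LipschitzWith.of_dist_le_mul fun b b' => ?_⟩
    rw [BoundedContinuousFunction.dist_le (by positivity)]
    intro r
    rw [Real.dist_eq, hS, hS, ← mul_sub, add_sub_add_left_eq_sub, hJsub]
    refine (hSb _ _).trans ?_
    rw [dist_eq_norm]
    push_cast
    linarith
  have hfix : S (ContractingWith.fixedPoint S hcon) = (ContractingWith.fixedPoint S hcon) := hcon.fixedPoint_isFixedPt
  have hpos : ∀ r, 0 ≤ (ContractingWith.fixedPoint S hcon) r := by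
    intro r
    have h1 := hcon.tendsto_iterate_fixedPoint 0
    have h2 := ((BoundedContinuousFunction.evalCLM ℝ r).continuous.tendsto _).comp h1
    refine ge_of_tendsto' h2 fun k => ?_
    have : ∀ k r, 0 ≤ (S^[k] 0) r := by
      intro k
      induction k with
      | zero => intro r; simp
      | succ k ih =>
        intro r
        rw [Function.iterate_succ_apply', hS]
        have : 0 ≤ J (S^[k] 0) |r| := by
          rw [hJ]
          refine intervalIntegral.integral_nonneg (abs_nonneg r) fun s hs => mul_nonneg hs.1 ?_
          rw [hI]
          refine intervalIntegral.integral_nonneg zero_le_one fun τ hτ => ?_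
          have := hq0 (s*τ)
          have := ih (s*τ)
          have := hτ.1
          positivity
        positivity
    exact this k r
  refine ⟨fun r => exp (κ r) * (ContractingWith.fixedPoint S hcon) r, by fun_prop, fun r => ?_, fun r hr => ?_⟩
  · have := hpos r; positivity
  · have h1 : (ContractingWith.fixedPoint S hcon) r = exp (-κ |r|) * (1 + J (ContractingWith.fixedPoint S hcon) |r|) := by
      rw [← hS, hfix]
    rw [abs_of_nonneg hr] at h1
    simp only
    rw [h1, ← mul_assoc, ← exp_add]
    simp [hJ, hI]

lemma radial_data (m : ℕ) (q : ℝ → ℝ) (hq : Continuous q) (hq0 : ∀ r, 0 ≤ q r) :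
    ∃ φ A : ℝ → ℝ, Continuous A ∧ (∀ r, HasDerivAt φ (r * A r) r) ∧ (∀ r, 0 ≤ r → 1 ≤ φ r) ∧
      (∀ r, 0 ≤ A r) ∧ A 0 = q 0 * φ 0 / ((m + 1 : ℕ) : ℝ) ∧
      ∀ r, 0 < r → HasDerivAt A ((q r * φ r - ((m + 1 : ℕ) : ℝ) * A r) / r) r := by
  obtain ⟨ψ, hψc, hψ0, hψ⟩ := exists_radial m q hq hq0
  obtain ⟨A, hA⟩ : ∃ A : ℝ → ℝ, A = fun s : ℝ => ∫ τ in (0:ℝ)..1, τ^m * (q (s*τ) * ψ (s*τ)) :=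
    ⟨_, rfl⟩
  have hAc : Continuous A := by
    rw [hA]; exact cont_I m (fun t => q t * ψ t) (by fun_prop)
  have hA0 : ∀ r, 0 ≤ A r := by
    intro r
    rw [hA]
    refine intervalIntegral.integral_nonneg zero_le_one fun τ hτ => ?_
    have := hq0 (r*τ)
    have := hψ0 (r*τ)
    have := hτ.1
    positivity
  obtain ⟨φ, hφ⟩ : ∃ φ : ℝ → ℝ, φ = fun r : ℝ => 1 + ∫ s in (0:ℝ)..r, s * A s := ⟨_, rfl⟩
  have hEq : ∀ r, 0 ≤ r → φ r = ψ r := by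
    intro r hr; rw [hψ r hr, hφ, hA]
  refine ⟨φ, A, hAc, ?_, ?_, hA0, ?_, ?_⟩
  · intro r
    have hc : Continuous (fun s => s * A s) := by fun_prop
    rw [hφ]
    exact (intervalIntegral.integral_hasDerivAt_right (hc.intervalIntegrable _ _)
      (hc.stronglyMeasurableAtFilter _ _) hc.continuousAt).const_add 1
  · intro r hr
    rw [hφ]
    have : 0 ≤ ∫ s in (0:ℝ)..r, s * A s :=
      intervalIntegral.integral_nonneg hr fun s hs => mul_nonneg hs.1 (hA0 s)
    simp only
    linarith
  · rw [hEq 0 le_rfl, hA]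
    simp only [zero_mul, intervalIntegral.integral_mul_const, integral_pow]
    simp
    ring
  · intro r hr
    rw [hEq r hr.le]
    have hc : Continuous (fun t => t^m * (q t * ψ t)) := by fun_prop
    have hF : HasDerivAt (fun r => ∫ t in (0:ℝ)..r, t^m * (q t * ψ t)) (r^m * (q r * ψ r)) r :=
      intervalIntegral.integral_hasDerivAt_right (hc.intervalIntegrable _ _)
      (hc.stronglyMeasurableAtFilter _ _) hc.continuousAt
    have key : ∀ s, 0 < s → s^(m+1) * A s = ∫ t in (0:ℝ)..s, t^m * (q t * ψ t) := by
      intro s hs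
      have h := intervalIntegral.integral_comp_mul_left (a := 0) (b := 1)
        (fun t => t^m * (q t * ψ t)) hs.ne'
      simp only [mul_zero, mul_one, smul_eq_mul] at h
      have h2 : ∫ x in (0:ℝ)..1, (s * x)^m * (q (s*x) * ψ (s*x)) = s^m * A s := by
        rw [hA]; simp only
        rw [← intervalIntegral.integral_const_mul]
        congr 1; ext x; ring
      rw [h2] at h
      rw [pow_succ, mul_right_comm, h]
      field_simp
    have hd := hF.div (hasDerivAt_pow (m+1) r) (by positivity)
    have he : A =ᶠ[nhds r] (fun r => ∫ t in (0:ℝ)..r, t^m * (q t * ψ t)) / (fun x => x^(m+1)) := by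
      filter_upwards [lt_mem_nhds hr] with s hs
      rw [Pi.div_apply, ← key s hs]
      field_simp
    refine (hd.congr_of_eventuallyEq he).congr_deriv ?_
    rw [← key r hr]
    field_simp
    push_cast
    ring

lemma hasFDerivAt_norm_aux {n : ℕ} (x : EuclideanSpace ℝ (Fin n)) (hx : x ≠ 0) :
    HasFDerivAt (fun y : EuclideanSpace ℝ (Fin n) => ‖y‖) (‖x‖⁻¹ • (innerSL ℝ x : EuclideanSpace ℝ (Fin n) →L[ℝ] ℝ)) x := by
  have h1 := (hasStrictFDerivAt_norm_sq x).hasFDerivAt.sqrt (by simpa using hx)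
  simp only [Real.sqrt_sq (norm_nonneg _)] at h1
  refine h1.congr_fderiv ?_
  ext y
  simp
  field_simp

lemma continuousAdd_aux (E F : Type) [NormedAddCommGroup E] [NormedSpace ℝ E]
    [NormedAddCommGroup F] [NormedSpace ℝ F] : ContinuousAdd (E →L[ℝ] F) := by
  have := (inferInstance : IsTopologicalAddGroup (E →L[ℝ] F))
  exact this.toContinuousAdd

lemma squeeze_aux {X : Type} (E F : Type) [NormedAddCommGroup E] [NormedSpace ℝ E]
    [NormedAddCommGroup F] [NormedSpace ℝ F] {u : X → E →L[ℝ] F} {a : X → ℝ} {l : Filter X}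
    (h : ∀ x, ‖u x‖ ≤ a x) (ha : Filter.Tendsto a l (nhds 0)) :
    Filter.Tendsto u l (nhds 0) := squeeze_zero_norm h ha

def innL (n : ℕ) : EuclideanSpace ℝ (Fin n) →L[ℝ] EuclideanSpace ℝ (Fin n) →L[ℝ] ℝ := innerSL ℝ

lemma innL_apply {n : ℕ} (x y : EuclideanSpace ℝ (Fin n)) : innL n x y = inner ℝ x y := rfl

lemma innL_eq {n : ℕ} (x : EuclideanSpace ℝ (Fin n)) : innL n x = innerSL ℝ x := rfl

lemma innL_norm {n : ℕ} (x : EuclideanSpace ℝ (Fin n)) : ‖innL n x‖ = ‖x‖ :=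
  innerSL_apply_norm (𝕜 := ℝ) x

lemma hasFDerivAt_norm_aux' {n : ℕ} (x : EuclideanSpace ℝ (Fin n)) (hx : x ≠ 0) :
    HasFDerivAt (fun y : EuclideanSpace ℝ (Fin n) => ‖y‖) (‖x‖⁻¹ • innL n x) x :=
  hasFDerivAt_norm_aux x hx

lemma radial_C2 {n : ℕ} (hn : 1 ≤ n) (φ A f : ℝ → ℝ) (hA : Continuous A) (hf : Continuous f)
    (hφ : ∀ r, HasDerivAt φ (r * A r) r) (hA0 : A 0 = f 0 / n)
    (hAd : ∀ r, 0 < r → HasDerivAt A ((f r - n * A r) / r) r) :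
    ContDiff ℝ 2 (fun x : EuclideanSpace ℝ (Fin n) => φ ‖x‖) ∧
    ∀ x : EuclideanSpace ℝ (Fin n), lap (fun x => φ ‖x‖) x = f ‖x‖ := by
  have hn0 : (n:ℝ) ≠ 0 := by positivity
  have h1 : ∀ x : EuclideanSpace ℝ (Fin n),
      HasFDerivAt (fun x : EuclideanSpace ℝ (Fin n) => φ ‖x‖) (A ‖x‖ • innL n x) x := by
    intro x
    by_cases hx : x = 0
    · subst hx
      have h := (hφ 0).isLittleO
      rw [hasFDerivAt_iff_isLittleO]
      have ht : Filter.Tendsto (fun x : EuclideanSpace ℝ (Fin n) => ‖x‖) (nhds 0) (nhds 0) := by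
        simpa using (continuous_norm (E := EuclideanSpace ℝ (Fin n))).tendsto 0
      have h2 := h.comp_tendsto ht
      simp only [Function.comp_def] at h2
      simp only [norm_zero, map_zero, smul_zero, sub_zero, zero_mul] at h2 ⊢
      rw [← Asymptotics.isLittleO_norm_right]
      simpa using h2
    · have h := (hφ ‖x‖).comp_hasFDerivAt x (hasFDerivAt_norm_aux' x hx)
      refine h.congr_fderiv ?_
      rw [smul_smul]
      congr 1
      have : ‖x‖ ≠ 0 := norm_ne_zero_iff.2 hx
      field_simp
  obtain ⟨H, hH⟩ : ∃ H : EuclideanSpace ℝ (Fin n) → EuclideanSpace ℝ (Fin n) →L[ℝ]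
      EuclideanSpace ℝ (Fin n) →L[ℝ] ℝ, H = fun x => A ‖x‖ • innL n +
        ((f ‖x‖ - n * A ‖x‖) / ‖x‖^2) • (innL n x).smulRight (innL n x) := ⟨_, rfl⟩
  have h2 : ∀ x : EuclideanSpace ℝ (Fin n),
      HasFDerivAt (fun x : EuclideanSpace ℝ (Fin n) => A ‖x‖ • innL n x) (H x) x := by
    intro x
    by_cases hx : x = 0
    · subst hx
      rw [hasFDerivAt_iff_isLittleO, hH]
      have e : ∀ x' : EuclideanSpace ℝ (Fin n), A ‖x'‖ • innL n x' - A ‖(0:EuclideanSpace ℝ (Fin n))‖ • innL n (0:EuclideanSpace ℝ (Fin n)) - (A ‖(0:EuclideanSpace ℝ (Fin n))‖ • innL n + ((f ‖(0:EuclideanSpace ℝ (Fin n))‖ - n * A ‖(0:EuclideanSpace ℝ (Fin n))‖) / ‖(0:EuclideanSpace ℝ (Fin n))‖^2) • (innL n (0:EuclideanSpace ℝ (Fin n))).smulRight (innL n (0:EuclideanSpace ℝ (Fin n)))) (x' - 0) = (A ‖x'‖ - A 0) • innL n x' := by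
        intro x'
        simp
        module
      simp only [e]
      have ht : Filter.Tendsto (fun x : EuclideanSpace ℝ (Fin n) => A ‖x‖ - A 0) (nhds 0) (nhds 0) := by
        have : Continuous (fun x : EuclideanSpace ℝ (Fin n) => A ‖x‖ - A 0) := by fun_prop
        simpa using this.tendsto 0
      have := ((Asymptotics.isLittleO_one_iff ℝ).2 ht).smul_isBigO
        (Asymptotics.isBigO_refl (fun x : EuclideanSpace ℝ (Fin n) => x) (nhds 0)).norm_left
      have h3 : (fun x : EuclideanSpace ℝ (Fin n) => (A ‖x‖ - A 0) • innL n x) =O[nhds 0] (fun x => (A ‖x‖ - A 0) • ‖x‖) := by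
        refine Asymptotics.IsBigO.of_bound 1 (Filter.Eventually.of_forall fun x => ?_)
        rw [norm_smul, norm_smul, innL_norm]; simp
      simpa using h3.trans_isLittleO this
    · have hx' : 0 < ‖x‖ := norm_pos_iff.2 hx
      have h := ((hAd ‖x‖ hx').comp_hasFDerivAt x (hasFDerivAt_norm_aux' x hx)).smul
        (innL n).hasFDerivAt
      refine h.congr_fderiv ?_
      rw [hH]
      ext y z
      simp [innL_apply]
      field_simp
  have hHc : Continuous H := by
    have hc : ∀ x : EuclideanSpace ℝ (Fin n), x ≠ 0 → ContinuousAt (fun x : EuclideanSpace ℝ (Fin n) =>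
        ((f ‖x‖ - n * A ‖x‖) / ‖x‖^2) • (innL n x).smulRight (innL n x)) x := by
      intro x hx
      have : ‖x‖^2 ≠ 0 := by simpa using hx
      have hs : Continuous (fun x : EuclideanSpace ℝ (Fin n) => (innL n x).smulRight (innL n x)) := by
        have h1 : Continuous fun x : EuclideanSpace ℝ (Fin n) => innL n x := (innL n).continuous
        have := ((ContinuousLinearMap.smulRightL ℝ (EuclideanSpace ℝ (Fin n)) (EuclideanSpace ℝ (Fin n) →L[ℝ] ℝ)).isBoundedBilinearMap.continuous).comp (h1.prodMk h1)
        exact this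
      refine ContinuousAt.smul (f := fun x : EuclideanSpace ℝ (Fin n) => (f ‖x‖ - n * A ‖x‖) / ‖x‖^2) ?_ hs.continuousAt
      refine ContinuousAt.div ?_ ?_ this
      · fun_prop
      · fun_prop
    rw [hH]
    have hadd : ContinuousAdd (EuclideanSpace ℝ (Fin n) →L[ℝ] EuclideanSpace ℝ (Fin n) →L[ℝ] ℝ) :=
      continuousAdd_aux _ _
    apply Continuous.fun_add
    · fun_prop
    · rw [continuous_iff_continuousAt]
      intro x
      by_cases hx : x = 0
      · subst hx
        rw [ContinuousAt]
        simp only [norm_zero, map_zero]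
        have : ((f 0 - n * A 0) / 0 ^ 2) • ((0 : EuclideanSpace ℝ (Fin n) →L[ℝ] ℝ).smulRight (0 : EuclideanSpace ℝ (Fin n) →L[ℝ] ℝ)) = 0 := by
          ext; simp
        rw [this]
        refine squeeze_aux _ _ (a := fun x : EuclideanSpace ℝ (Fin n) => |f ‖x‖ - n * A ‖x‖|) ?_ ?_
        · intro x
          rw [norm_smul, ContinuousLinearMap.norm_smulRight_apply, innL_norm, norm_div, Real.norm_eq_abs, norm_pow, norm_norm]
          by_cases hx : x = 0
          · subst hx; simp
          · have : ‖x‖ ≠ 0 := norm_ne_zero_iff.2 hx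
            apply le_of_eq
            field_simp
        · have : Continuous (fun x : EuclideanSpace ℝ (Fin n) => |f ‖x‖ - n * A ‖x‖|) := by fun_prop
          have h := this.tendsto 0
          simp only [norm_zero, hA0] at h
          rwa [mul_div_cancel₀ _ hn0, sub_self, abs_zero] at h
      · exact hc x hx
  constructor
  · rw [show (2 : WithTop ℕ∞) = ((1:ℕ) : WithTop ℕ∞) + 1 by norm_num, contDiff_succ_iff_hasFDerivAt]
    refine ⟨_, ?_, h1⟩
    rw [Nat.cast_one, contDiff_one_iff_hasFDerivAt]
    exact ⟨H, hHc, h2⟩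
  · intro x
    unfold lap
    have hf1 : ∀ y : EuclideanSpace ℝ (Fin n), fderiv ℝ (fun x : EuclideanSpace ℝ (Fin n) => φ ‖x‖) y = A ‖y‖ • innL n y :=
      fun y => (h1 y).fderiv
    simp only [hf1]
    have hf2 : ∀ i : Fin n, fderiv ℝ (fun y : EuclideanSpace ℝ (Fin n) => (A ‖y‖ • innL n y) (EuclideanSpace.single i 1)) x
        (EuclideanSpace.single i 1) = A ‖x‖ + (f ‖x‖ - n * A ‖x‖) / ‖x‖^2 * (x i)^2 := by
      intro i
      have := (h2 x).clm_apply (hasFDerivAt_const (EuclideanSpace.single i (1:ℝ)) x)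
      rw [this.fderiv, hH]
      simp [innL_apply, EuclideanSpace.inner_single_right]
      ring_nf
      simp
    simp only [hf2]
    rw [Finset.sum_add_distrib, ← Finset.mul_sum, ← EuclideanSpace.real_norm_sq_eq]
    simp
    by_cases hx : x = 0
    · subst hx
      simp [hA0]
      field_simp
    · have : ‖x‖ ≠ 0 := norm_ne_zero_iff.2 hx
      field_simp
      ring

lemma one_side (W z k g Γ : ℝ → ℝ) (R c G σ : ℝ) (hc : 0 < c) (hσ : |σ| ≤ 1)
    (hW : ∀ r, R ≤ r → HasDerivAt W (z r) r)
    (hz : ∀ r, R ≤ r → HasDerivAt z (-(z r * k r) + g r) r)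
    (hk : ∀ r, R ≤ r → c ≤ k r)
    (hΓ : ∀ r, R ≤ r → HasDerivAt Γ |g r| r) (hG : ∀ r, R ≤ r → Γ r - Γ R ≤ G)
    (T : ℝ) (hT : R ≤ T) :
    c * (σ * (W T - W R)) ≤ |z R| + 1 + G + c := by
  obtain ⟨ε, hε, hε1, hεT⟩ : ∃ ε : ℝ, 0 < ε ∧ ε ≤ 1 ∧ ε * (T - R) ≤ 1 := by
    refine ⟨1 / (T - R + 1), by have : 0 < T - R + 1 := by linarith
                                positivity, ?_, ?_⟩
    · rw [div_le_one (by linarith)]; linarith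
    · rw [div_mul_eq_mul_div, div_le_one (by linarith)]; linarith
  have hF2 : ∀ r, 0 < z r ^ 2 + ε ^ 2 := fun r => by positivity
  have hder : ∀ r, R ≤ r → HasDerivAt
      (fun r => c * (σ * W r) + sqrt (z r ^ 2 + ε ^ 2) - Γ r - c * ε * r)
      (c * (σ * z r) + (2 * z r * (-(z r * k r) + g r)) / (2 * sqrt (z r ^ 2 + ε ^ 2)) - |g r|
        - c * ε) r := by
    intro r hr
    have h1 := (((hz r hr).pow 2).add_const (ε ^ 2)).sqrt (hF2 r).ne'
    have h2 := ((((hW r hr).const_mul σ).const_mul c).add h1).sub (hΓ r hr)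
    have h3 := h2.sub ((hasDerivAt_id r).const_mul (c * ε))
    refine h3.congr_deriv ?_
    simp
  have hanti : AntitoneOn (fun r => c * (σ * W r) + sqrt (z r ^ 2 + ε ^ 2) - Γ r - c * ε * r)
      (Icc R T) := by
    apply antitoneOn_of_deriv_nonpos (convex_Icc R T)
    · exact fun r hr => (hder r hr.1).continuousAt.continuousWithinAt
    · intro r hr
      rw [interior_Icc] at hr
      exact (hder r hr.1.le).differentiableAt.differentiableWithinAt
    · intro r hr
      rw [interior_Icc] at hr
      rw [(hder r hr.1.le).deriv]
      set F := sqrt (z r ^ 2 + ε ^ 2) with hFdef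
      have hFpos : 0 < F := Real.sqrt_pos.2 (hF2 r)
      have hFsq : F ^ 2 = z r ^ 2 + ε ^ 2 := Real.sq_sqrt (hF2 r).le
      have hzF : |z r| ≤ F := by
        rw [hFdef]; apply Real.abs_le_sqrt; nlinarith
      have hFle : F ≤ |z r| + ε := by
        rw [hFdef, Real.sqrt_le_left (by positivity)]
        nlinarith [sq_abs (z r), abs_nonneg (z r)]
      have hgz : g r * z r ≤ |g r| * F := by
        calc g r * z r ≤ |g r * z r| := le_abs_self _
          _ = |g r| * |z r| := abs_mul _ _
          _ ≤ _ := by gcongr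
      have hσz : σ * z r ≤ |z r| := by
        calc σ * z r ≤ |σ * z r| := le_abs_self _
          _ = |σ| * |z r| := abs_mul _ _
          _ ≤ 1 * |z r| := by gcongr
          _ = _ := one_mul _
      have hkz : c * z r ^ 2 ≤ k r * z r ^ 2 := by
        have := hk r hr.1.le; gcongr
      have hmain : F * (|z r| - ε) ≤ z r ^ 2 := by
        rcases le_total |z r| ε with h | h
        · nlinarith [sq_nonneg (z r)]
        · nlinarith [sq_abs (z r)]
      have e : c * (σ * z r) + (2 * z r * (-(z r * k r) + g r)) / (2 * F) - |g r| - c * ε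
          = (F * (c * (σ * z r)) - k r * z r ^ 2 + g r * z r - F * |g r| - F * (c * ε)) / F := by
        field_simp
        ring
      rw [e]
      apply div_nonpos_of_nonpos_of_nonneg _ hFpos.le
      have h5 : F * (c * (σ * z r)) ≤ F * (c * |z r|) := by gcongr
      have h6 := mul_le_mul_of_nonneg_left hmain hc.le
      nlinarith
  have h := hanti (left_mem_Icc.2 hT) (right_mem_Icc.2 hT) hT
  simp only at h
  have h1 := Real.sqrt_nonneg (z T ^ 2 + ε ^ 2)
  have h2 : sqrt (z R ^ 2 + ε ^ 2) ≤ |z R| + 1 := by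
    rw [Real.sqrt_le_left (by positivity)]
    nlinarith [sq_abs (z R), abs_nonneg (z R)]
  have h3 := hG T hT
  have h4 : c * (ε * (T - R)) ≤ c * 1 := by gcongr
  nlinarith

lemma two_side (W z k g Γ : ℝ → ℝ) (R c G : ℝ) (hc : 0 < c)
    (hW : ∀ r, R ≤ r → HasDerivAt W (z r) r)
    (hz : ∀ r, R ≤ r → HasDerivAt z (-(z r * k r) + g r) r)
    (hk : ∀ r, R ≤ r → c ≤ k r)
    (hΓ : ∀ r, R ≤ r → HasDerivAt Γ |g r| r) (hG : ∀ r, R ≤ r → Γ r - Γ R ≤ G) :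
    ∃ M, ∀ T, R ≤ T → |W T - W R| ≤ M := by
  refine ⟨(|z R| + 1 + G + c) / c, fun T hT => ?_⟩
  have h1 := one_side W z k g Γ R c G 1 hc (by simp) hW hz hk hΓ hG T hT
  have h2 := one_side W z k g Γ R c G (-1) hc (by simp) hW hz hk hΓ hG T hT
  rw [le_div_iff₀ hc]
  rcases abs_cases (W T - W R) with h | h <;> rw [h.1] <;> linarith

lemma asym (m : ℕ) (lam d R : ℝ) (hlam : 0 < lam) (hR : 1 < R) (q φ A : ℝ → ℝ) (hq : Continuous q)
    (hφ : ∀ r, HasDerivAt φ (r * A r) r) (hφ1 : ∀ r, 0 ≤ r → 1 ≤ φ r) (hA0 : ∀ r, 0 ≤ A r)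
    (hAd : ∀ r, 0 < r → HasDerivAt A ((q r * φ r - ((m + 1 : ℕ) : ℝ) * A r) / r) r)
    (hint : IntegrableOn (fun r => q r - lam ^ 2 - lam * (d / r)) (Ici R)) :
    ∃ C, ∀ r, 0 ≤ r → |log (φ r) - lam * r - ((d - m) / 2) * log (1 + r)| ≤ C := by
  obtain ⟨β, hβ⟩ : ∃ β, β = (d - m) / 2 := ⟨_, rfl⟩
  rw [← hβ]
  have hd : d = 2 * β + m := by rw [hβ]; ring
  obtain ⟨R1, hR1⟩ : ∃ R1, R1 = R + 2 * |β| / lam := ⟨_, rfl⟩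
  have hRR1 : R ≤ R1 := by
    rw [hR1]; have : 0 ≤ 2 * |β| / lam := by positivity
    linarith
  let g : ℝ → ℝ := fun r => q r + β / r ^ 2 - (lam + β / r) ^ 2 - m * (lam + β / r) / r
  have hgc : ContinuousOn g (Ioi 0) := by
    intro r hr
    have : r ≠ 0 := ne_of_gt hr
    have h2 : r ^ 2 ≠ 0 := pow_ne_zero 2 this
    apply ContinuousAt.continuousWithinAt
    have := hq.continuousAt (x := r)
    fun_prop (disch := assumption)
  have hgi : IntegrableOn g (Ici R) := by
    have h1 : IntegrableOn (fun r : ℝ => r ^ (-2 : ℝ)) (Ici R) := by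
      rw [integrableOn_Ici_iff_integrableOn_Ioi]
      exact integrableOn_Ioi_rpow_of_lt (by norm_num) (by linarith)
    have h2 := hint.add (h1.const_mul (β - β ^ 2 - m * β))
    refine h2.congr_fun (fun r hr => ?_) measurableSet_Ici
    have hr0 : 0 < r := by have : R ≤ r := hr
                           linarith
    simp only [g, Pi.add_apply]
    rw [Real.rpow_neg hr0.le, Real.rpow_two, hd]
    field_simp
    ring
  let Γ : ℝ → ℝ := fun r => ∫ t in R1..r, |g t|
  have hgi1 : IntegrableOn (fun t => |g t|) (Ici R1) :=
    (hgi.mono_set (Ici_subset_Ici.2 hRR1)).abs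
  have hII : ∀ r, R1 ≤ r → IntervalIntegrable (fun t => |g t|) volume R1 r := fun r hr => by
    rw [intervalIntegrable_iff_integrableOn_Icc_of_le hr]
    exact hgi1.mono_set Icc_subset_Ici_self
  have hpos : ∀ r, R1 ≤ r → 0 < r := fun r hr => by linarith
  have hphi : ∀ r, 0 ≤ r → 0 < φ r := fun r hr => by linarith [hφ1 r hr]
  have key := two_side (fun r => log (φ r) - lam * r - β * log r)
    (fun r => r * A r / φ r - (lam + β / r))
    (fun r => r * A r / φ r + (lam + β / r) + m / r) g Γ R1 (lam / 2) (∫ t in Ici R1, |g t|)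
    (by positivity) ?_ ?_ ?_ ?_ ?_
  · obtain ⟨M, hM⟩ := key
    have hcont : ContinuousOn (fun r => log (φ r) - lam * r - β * log (1 + r)) (Icc 0 R1) := by
      intro r hr
      apply ContinuousAt.continuousWithinAt
      have h1 : φ r ≠ 0 := (hphi r hr.1).ne'
      have h2 : 1 + r ≠ 0 := by linarith [hr.1]
      have := (hφ r).continuousAt
      fun_prop (disch := assumption)
    obtain ⟨C, hC⟩ := isCompact_Icc.exists_bound_of_continuousOn hcont
    obtain ⟨W1, hW1⟩ : ∃ W1, W1 = log (φ R1) - lam * R1 - β * log R1 := ⟨_, rfl⟩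
    refine ⟨max C (M + |W1| + |β| * log 2), fun r hr => ?_⟩
    rcases le_total r R1 with h | h
    · exact (hC r ⟨hr, h⟩).trans (le_max_left _ _)
    · refine le_trans ?_ (le_max_right _ _)
      have h1 := hM r h
      rw [← hW1] at h1
      have hr0 := hpos r h
      have h2 : |log r - log (1 + r)| ≤ log 2 := by
        rw [abs_sub_comm, abs_of_nonneg]
        · rw [← Real.log_div (by linarith) hr0.ne']
          apply Real.log_le_log (by positivity)
          rw [div_le_iff₀ hr0]; linarith
        · have := Real.log_le_log hr0 (by linarith : r ≤ 1 + r)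
          linarith
      have h3 : |β * (log r - log (1 + r))| ≤ |β| * log 2 := by
        rw [abs_mul]; gcongr
      have e : log (φ r) - lam * r - β * log (1 + r) = (log (φ r) - lam * r - β * log r - W1) + W1
        + β * (log r - log (1 + r)) := by ring
      rw [e]
      exact (abs_add_three _ _ _).trans (by linarith)
  · intro r hr
    have hr0 := hpos r hr
    have h1 := (hφ r).log (hphi r hr0.le).ne'
    have h2 := (h1.sub ((hasDerivAt_id r).const_mul lam)).sub ((Real.hasDerivAt_log hr0.ne').const_mul β)
    refine h2.congr_deriv ?_
    field_simp
    ring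
  · intro r hr
    have hr0 := hpos r hr
    have hp := hphi r hr0.le
    have h1 := ((hasDerivAt_id r).mul (hAd r hr0)).div (hφ r) hp.ne'
    have h2 := h1.sub (((hasDerivAt_inv hr0.ne').const_mul β).const_add lam)
    refine h2.congr_deriv ?_
    simp only [g, id, Pi.mul_apply]
    push_cast
    field_simp
    ring
  · intro r hr
    have hr0 := hpos r hr
    have hp := hphi r hr0.le
    have h1 : 0 ≤ r * A r / φ r := by have := hA0 r; positivity
    have h2 : (0:ℝ) ≤ m / r := by positivity
    have h3 : -(lam / 2) ≤ β / r := by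
      rw [le_div_iff₀ hr0]
      have h4 : 2 * |β| / lam ≤ r := by linarith
      rw [div_le_iff₀ hlam] at h4
      have := neg_abs_le β
      linarith
    linarith
  · intro r hr
    have hr0 := hpos r hr
    have hcc : ContinuousOn (fun t => |g t|) (Ioi 0) := hgc.abs
    exact intervalIntegral.integral_hasDerivAt_right (hII r hr)
      (hcc.stronglyMeasurableAtFilter isOpen_Ioi r hr0)
      (hcc.continuousAt (Ioi_mem_nhds hr0))
  · intro r hr
    simp only [Γ, intervalIntegral.integral_same, sub_zero]
    rw [intervalIntegral.integral_of_le hr]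
    apply setIntegral_mono_set hgi1
    · exact Filter.Eventually.of_forall fun t => abs_nonneg _
    · exact (Ioc_subset_Icc_self.trans Icc_subset_Ici_self).eventuallyLE

theorem exists_phi_lambda
    (n : ℕ) (hn : 2 ≤ n) (lam : ℝ) (hlam : 0 < lam)
    (V D : EuclideanSpace ℝ (Fin n) → ℝ)
    (hVcont : Continuous V) (hDcont : Continuous D)
    (gV gD : ℝ → ℝ) (hVrad : ∀ x, V x = gV ‖x‖) (hDrad : ∀ x, D x = gD ‖x‖)
    (hVhold : ∃ δ : ℝ≥0, 0 < δ ∧ ∃ K : ℝ≥0,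
      HolderOnWith K δ V (closedBall (0 : EuclideanSpace ℝ (Fin n)) (δ : ℝ)))
    (hDhold : ∃ δ : ℝ≥0, 0 < δ ∧ ∃ K : ℝ≥0,
      HolderOnWith K δ D (closedBall (0 : EuclideanSpace ℝ (Fin n)) (δ : ℝ)))
    (hVnn : ∀ x, 0 ≤ V x) (hDlb : ∀ x, -lam - V x / lam ≤ D x)
    (dinf R : ℝ) (hR : 1 < R)
    (hVL1 : IntegrableOn gV (Ici R))
    (hDdec : ∃ Dinf : ℝ → ℝ, (∀ r ∈ Ici R, gD r = dinf / r + Dinf r) ∧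
      IntegrableOn Dinf (Ici R)) :
    ∃ φ : EuclideanSpace ℝ (Fin n) → ℝ, ContDiff ℝ 2 φ ∧
      (∀ x, lap φ x = (lam ^ 2 + lam * D x + V x) * φ x) ∧
      ∃ c₁ > (0:ℝ), ∃ c₂ > (0:ℝ), ∀ x,
        c₁ * (1 + ‖x‖) ^ (-(((n : ℝ) - 1 - dinf)/2)) * Real.exp (lam * ‖x‖) ≤ φ x ∧
        φ x ≤ c₂ * (1 + ‖x‖) ^ (-(((n : ℝ) - 1 - dinf)/2)) * Real.exp (lam * ‖x‖) := by
  
  obtain ⟨m, rfl⟩ : ∃ m, n = m + 1 := ⟨n - 1, by omega⟩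
  obtain ⟨Dinf, hDinf, hDint⟩ := hDdec
  obtain ⟨e, he⟩ : ∃ e : EuclideanSpace ℝ (Fin (m + 1)), ‖e‖ = 1 :=
    ⟨EuclideanSpace.single 0 1, by simp⟩
  obtain ⟨q, hq⟩ : ∃ q : ℝ → ℝ, q = fun r => lam ^ 2 + lam * D (r • e) + V (r • e) := ⟨_, rfl⟩
  have hqc : Continuous q := by rw [hq]; fun_prop
  have hq0 : ∀ r, 0 ≤ q r := by
    intro r
    have h := mul_le_mul_of_nonneg_left (hDlb (r • e)) hlam.le
    rw [mul_sub, mul_div_cancel₀ _ hlam.ne'] at h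
    rw [hq]
    simp only
    nlinarith
  have hqn : ∀ r, 0 ≤ r → q r = lam ^ 2 + lam * gD r + gV r := by
    intro r hr
    rw [hq]
    simp only [hDrad, hVrad, norm_smul, he, mul_one, Real.norm_of_nonneg hr]
  obtain ⟨φ, A, hAc, hφ, hφ1, hA0, hAz, hAd⟩ := radial_data m q hqc hq0
  have hφc : Continuous φ := continuous_iff_continuousAt.2 fun r => (hφ r).continuousAt
  obtain ⟨h1, h2⟩ := radial_C2 (n := m + 1) (by omega) φ A (fun r => q r * φ r) hAc (by fun_prop)
    hφ hAz hAd
  have hint : IntegrableOn (fun r => q r - lam ^ 2 - lam * (dinf / r)) (Ici R) := by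
    have hs : IntegrableOn ((fun r => lam * Dinf r) + gV) (Ici R) := (hDint.const_mul lam).add hVL1
    refine hs.congr_fun (fun r hr => ?_) measurableSet_Ici
    have hr0 : 0 ≤ r := by have : R ≤ r := hr
                           linarith
    simp only [Pi.add_apply]
    rw [hqn r hr0, hDinf r hr]
    ring
  obtain ⟨C, hC⟩ := asym m lam dinf R hlam hR q φ A hqc hφ hφ1 hA0 hAd hint
  refine ⟨fun x => φ ‖x‖, h1, fun x => ?_, exp (-C), exp_pos _, exp C, exp_pos _, fun x => ?_⟩
  · rw [h2 x, hqn _ (norm_nonneg x), hDrad, hVrad]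
  · have hx := norm_nonneg x
    have hb := abs_le.1 (hC ‖x‖ hx)
    have hp : 0 < φ ‖x‖ := by linarith [hφ1 _ hx]
    rw [Real.rpow_def_of_pos (by linarith), ← exp_add, ← exp_add, ← exp_add, ← exp_add]
    push_cast
    constructor
    · rw [← Real.le_log_iff_exp_le hp]; linarith
    · rw [← Real.log_le_iff_le_exp hp]; linarith
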